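/- Let X be a nontrivial real Banach space. Then X is a Hilbert space (i.e., its norm is induced by an inner product) if and only if L^I_YJ(τ, υ, X) = 2(τ²+υ²)/υ² for all τ, υ > 0. -/

import Mathlib

noncomputable section

/-- Isosceles orthogonality: `x ⊥_I y` iff `‖x + y‖ = ‖x - y‖`. -/
def IsoOrth {X : Type*} [NormedAddCommGroup X] (x y : X) : Prop := ‖x + y‖ = ‖x - y‖

variable (X : Type*) [NormedAddCommGroup X] [NormedSpace ℝ X]

/-- The constant `H̃(X)`. -/
def Htilde : ℝ :=
  sSup {r : ℝ | ∃ x y : X, (x, y) ≠ (0, 0) ∧ IsoOrth x y ∧ r = (‖x‖ + ‖y‖) / ‖x + y‖}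

/-- The constant `A₂(X)`. -/
def A2 : ℝ :=
  sSup {r : ℝ | ∃ x y : X, ‖x‖ = 1 ∧ ‖y‖ = 1 ∧ r = (‖x + y‖ + ‖x - y‖) / 2}

/-- Clarkson's modulus of convexity `δ_X(ε)`. -/
def modulusConvexity (ε : ℝ) : ℝ :=
  sInf {r : ℝ | ∃ x y : X, ‖x‖ ≤ 1 ∧ ‖y‖ ≤ 1 ∧ ε ≤ ‖x - y‖ ∧ r = 1 - ‖x + y‖ / 2}

/-- The constant `H̃²(X)`. -/
def HtildeSq : ℝ :=
  sSup {r : ℝ | ∃ x y : X, (x, y) ≠ (0, 0) ∧ IsoOrth x y ∧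
    r = (‖x‖ ^ 2 + ‖y‖ ^ 2) / ‖x + y‖ ^ 2}

/-- The modified von Neumann–Jordan constant `C′_NJ(X)`. -/
def CNJmod : ℝ :=
  sSup {r : ℝ | ∃ x y : X, ‖x‖ = 1 ∧ ‖y‖ = 1 ∧ r = (‖x + y‖ ^ 2 + ‖x - y‖ ^ 2) / 4}

/-- The von Neumann–Jordan constant `C_NJ(X)`. -/
def CNJ : ℝ :=
  sSup {r : ℝ | ∃ x y : X, (x, y) ≠ (0, 0) ∧
    r = (‖x + y‖ ^ 2 + ‖x - y‖ ^ 2) / (2 * ‖x‖ ^ 2 + 2 * ‖y‖ ^ 2)}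

/-- The James constant in its isosceles-orthogonality form. -/
def JamesConst : ℝ :=
  sSup {r : ℝ | ∃ x y : X, ‖x‖ ≤ 1 ∧ ‖y‖ ≤ 1 ∧ IsoOrth x y ∧ r = ‖x + y‖}

/-- The constant `E_I(t, X)`. -/
def EI (t : ℝ) : ℝ :=
  sSup {r : ℝ | ∃ x y : X, (x, y) ≠ (0, 0) ∧ IsoOrth x y ∧
    r = (‖(t + 1) • x + (1 - t) • y‖ ^ 2 + ‖(1 - t) • x - (t + 1) • y‖ ^ 2) / ‖x + y‖ ^ 2}

/-- The skew constant `E(t, X)`. -/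
def Eskew (t : ℝ) : ℝ :=
  sSup {r : ℝ | ∃ x y : X, ‖x‖ = 1 ∧ ‖y‖ = 1 ∧ r = ‖x + t • y‖ ^ 2 + ‖t • x - y‖ ^ 2}

/-- The constant `L^I_YJ(τ, υ, X)`. -/
def LIYJ (τ υ : ℝ) : ℝ :=
  sSup {r : ℝ | ∃ x y : X, (x, y) ≠ (0, 0) ∧ IsoOrth x y ∧
    r = (‖(τ + υ) • x + (υ - τ) • y‖ ^ 2 + ‖(υ - τ) • x - (τ + υ) • y‖ ^ 2) /
      (υ ^ 2 * ‖x + y‖ ^ 2)}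

/-- The modified skew von Neumann–Jordan constant `L′_YJ(τ, υ, X)`. -/
def LYJmod (τ υ : ℝ) : ℝ :=
  sSup {r : ℝ | ∃ x y : X, ‖x‖ = 1 ∧ ‖y‖ = 1 ∧
    r = (‖τ • x + υ • y‖ ^ 2 + ‖υ • x - τ • y‖ ^ 2) / (2 * (τ ^ 2 + υ ^ 2))}

end

section EqualNormPairs

variable {X : Type*} [NormedAddCommGroup X] [NormedSpace ℝ X]

/-- In an inner product space, rotating a pair of vectors of equal norm preserves
the sum of the squared norms up to the scaling factor. -/
theorem norm_sq_add_norm_sq_rotate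
    (h : ∀ x y : X, ‖x + y‖ ^ 2 + ‖x - y‖ ^ 2 = 2 * ‖x‖ ^ 2 + 2 * ‖y‖ ^ 2)
    (a b : ℝ) (u v : X) (huv : ‖u‖ = ‖v‖) :
    ‖a • u + b • v‖ ^ 2 + ‖a • v - b • u‖ ^ 2 = 2 * (a ^ 2 + b ^ 2) * ‖u‖ ^ 2 := by
  let _ : InnerProductSpace ℝ X := InnerProductSpace.ofNorm ℝ fun x y => by
    linear_combination h x y
  rw [norm_add_sq_real, norm_sub_sq_real]
  simp only [norm_smul, real_inner_smul_left, real_inner_smul_right, mul_pow,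
    Real.norm_eq_abs, sq_abs, ← huv]
  rw [real_inner_comm u v]
  ring

/-- The set defining `LIYJ` is bounded above. -/
theorem bddAbove_LIYJ (τ υ : ℝ) (hτ : 0 < τ) (hυ : 0 < υ) :
    BddAbove {r : ℝ | ∃ x y : X, (x, y) ≠ (0, 0) ∧ IsoOrth x y ∧
      r = (‖(τ + υ) • x + (υ - τ) • y‖ ^ 2 + ‖(υ - τ) • x - (τ + υ) • y‖ ^ 2) /
        (υ ^ 2 * ‖x + y‖ ^ 2)} := by
  refine ⟨2 * (υ + τ) ^ 2 / υ ^ 2, ?_⟩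
  rintro r ⟨x, y, -, hiso, rfl⟩
  have h1 : (τ + υ) • x + (υ - τ) • y = υ • (x + y) + τ • (x - y) := by module
  have h2 : (υ - τ) • x - (τ + υ) • y = υ • (x - y) - τ • (x + y) := by module
  have hiso' : ‖x - y‖ = ‖x + y‖ := hiso.symm
  have b1 : ‖υ • (x + y) + τ • (x - y)‖ ≤ (υ + τ) * ‖x + y‖ := by
    refine (norm_add_le _ _).trans_eq ?_
    rw [norm_smul_of_nonneg hυ.le, norm_smul_of_nonneg hτ.le, hiso']
    ring
  have b2 : ‖υ • (x - y) - τ • (x + y)‖ ≤ (υ + τ) * ‖x + y‖ := by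
    refine (norm_sub_le _ _).trans_eq ?_
    rw [norm_smul_of_nonneg hυ.le, norm_smul_of_nonneg hτ.le, hiso']
    ring
  rw [h1, h2]
  rcases eq_or_ne ‖x + y‖ 0 with h0 | h0
  · rw [h0]
    simp only [ne_eq, OfNat.ofNat_ne_zero, not_false_eq_true, zero_pow, mul_zero, div_zero]
    positivity
  · have : 0 < ‖x + y‖ := (norm_nonneg _).lt_of_ne' h0
    rw [div_le_div_iff₀ (by positivity) (by positivity)]
    have c1 := pow_le_pow_left₀ (norm_nonneg _) b1 2
    have c2 := pow_le_pow_left₀ (norm_nonneg _) b2 2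
    have := mul_le_mul_of_nonneg_right (add_le_add c1 c2) (sq_nonneg υ)
    linarith

/-- A bound on `LIYJ` yields the corresponding inequality for pairs of unit vectors. -/
theorem norm_sq_add_norm_sq_rotate_le_of_pos {τ υ : ℝ} (hτ : 0 < τ) (hυ : 0 < υ)
    (h : LIYJ X τ υ = 2 * (τ ^ 2 + υ ^ 2) / υ ^ 2) {u v : X} (hu : ‖u‖ = 1) (hv : ‖v‖ = 1) :
    ‖υ • u + τ • v‖ ^ 2 + ‖υ • v - τ • u‖ ^ 2 ≤ 2 * (υ ^ 2 + τ ^ 2) := by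
  set x : X := (1 / 2 : ℝ) • (u + v) with hx
  set y : X := (1 / 2 : ℝ) • (u - v) with hy
  have hadd : x + y = u := by rw [hx, hy]; module
  have hsub : x - y = v := by rw [hx, hy]; module
  have h1 : (τ + υ) • x + (υ - τ) • y = υ • u + τ • v := by rw [hx, hy]; module
  have h2 : (υ - τ) • x - (τ + υ) • y = υ • v - τ • u := by rw [hx, hy]; module
  have hne : (x, y) ≠ (0, 0) := by
    intro h0
    obtain ⟨hx0, hy0⟩ := Prod.mk.inj h0
    rw [← hadd, hx0, hy0] at hu
    simp at hu
  have hiso : IsoOrth x y := by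
    unfold IsoOrth
    rw [hadd, hsub, hu, hv]
  have hle := le_csSup (bddAbove_LIYJ (X := X) τ υ hτ hυ) ⟨x, y, hne, hiso, rfl⟩
  have hle' := hle.trans_eq h
  rw [h1, h2, hadd, hu, one_pow, mul_one,
    div_le_div_iff_of_pos_right (by positivity)] at hle'
  linarith

/-- The inequality for positive coefficients extends to all real coefficients. -/
theorem norm_sq_add_norm_sq_rotate_le
    (h : ∀ a b : ℝ, 0 < a → 0 < b → ∀ u v : X, ‖u‖ = 1 → ‖v‖ = 1 →
      ‖a • u + b • v‖ ^ 2 + ‖a • v - b • u‖ ^ 2 ≤ 2 * (a ^ 2 + b ^ 2))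
    (a b : ℝ) {u v : X} (hu : ‖u‖ = 1) (hv : ‖v‖ = 1) :
    ‖a • u + b • v‖ ^ 2 + ‖a • v - b • u‖ ^ 2 ≤ 2 * (a ^ 2 + b ^ 2) := by
  rcases eq_or_ne a 0 with rfl | ha
  · simp [norm_smul, hu, hv]
    linarith
  rcases eq_or_ne b 0 with rfl | hb
  · simp [norm_smul, hu, hv]
    linarith
  have of_pos : ∀ a : ℝ, 0 < a → ∀ u v : X, ‖u‖ = 1 → ‖v‖ = 1 →
      ‖a • u + b • v‖ ^ 2 + ‖a • v - b • u‖ ^ 2 ≤ 2 * (a ^ 2 + b ^ 2) := by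
    intro a ha u v hu hv
    rcases hb.lt_or_gt with hb | hb
    · have := h a (-b) ha (neg_pos.2 hb) u (-v) hu (by rwa [norm_neg])
      rwa [neg_sq, show a • u + (-b) • (-v) = a • u + b • v by module,
        show a • (-v) - (-b) • u = -(a • v - b • u) by module, norm_neg] at this
    · exact h a b ha hb u v hu hv
  rcases ha.lt_or_gt with ha | ha
  · have := of_pos (-a) (neg_pos.2 ha) (-u) v (by rwa [norm_neg]) hv
    rwa [neg_sq, show (-a) • (-u) + b • v = a • u + b • v by module,
      show (-a) • v - b • (-u) = -(a • v - b • u) by module, norm_neg] at this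
  · exact of_pos a ha u v hu hv

/-- The determinant of a pair of plane vectors. -/
def planeDet (p q : ℝ × ℝ) : ℝ := p.1 * q.2 - p.2 * q.1

/-- For an injective linear map `T` from the plane, some pair of vectors mapped to unit vectors
has maximal determinant. -/
theorem exists_maximal_planeDet (T : ℝ × ℝ →ₗ[ℝ] X) (hT : Function.Injective T) :
    ∃ p q : ℝ × ℝ, ‖T p‖ = 1 ∧ ‖T q‖ = 1 ∧ 0 < planeDet p q ∧
      ∀ w z : ℝ × ℝ, planeDet w z ≤ planeDet p q * (‖T w‖ * ‖T z‖) := by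
  obtain ⟨K, hK, hanti⟩ := T.exists_antilipschitzWith (LinearMap.ker_eq_bot.2 hT)
  have hcont : Continuous T := T.continuous_of_finiteDimensional
  have hpos : ∀ w : ℝ × ℝ, w ≠ 0 → 0 < ‖T w‖ := fun w hw =>
    norm_pos_iff.2 ((map_ne_zero_iff T hT).2 hw)
  have hunit : ∀ w : ℝ × ℝ, w ≠ 0 → ‖T (‖T w‖⁻¹ • w)‖ = 1 := by
    intro w hw
    rw [map_smul, norm_smul, norm_inv, norm_norm, inv_mul_cancel₀ (hpos w hw).ne']
  set S : Set (ℝ × ℝ) := {w | ‖T w‖ = 1} with hS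
  have hcompact : IsCompact S := by
    refine Metric.isCompact_of_isClosed_isBounded
      (isClosed_eq hcont.norm continuous_const) ?_
    refine isBounded_iff_forall_norm_le.2 ⟨K, fun w hw => ?_⟩
    have := hanti.le_mul_dist w 0
    rw [map_zero, dist_zero_right, dist_zero_right, show ‖T w‖ = 1 from hw, mul_one] at this
    exact this
  have he₁ : ((1, 0) : ℝ × ℝ) ≠ 0 := by simp
  have he₂ : ((0, 1) : ℝ × ℝ) ≠ 0 := by simp
  have hD : Continuous fun w : (ℝ × ℝ) × (ℝ × ℝ) => planeDet w.1 w.2 := by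
    unfold planeDet
    fun_prop
  obtain ⟨⟨p, q⟩, ⟨hp, hq⟩, hmax⟩ := (hcompact.prod hcompact).exists_isMaxOn
    ⟨(_, _), hunit _ he₁, hunit _ he₂⟩ hD.continuousOn
  have hle : ∀ w z : ℝ × ℝ, w ≠ 0 → z ≠ 0 →
      planeDet w z ≤ planeDet p q * (‖T w‖ * ‖T z‖) := by
    intro w z hw hz
    have h : planeDet (‖T w‖⁻¹ • w) (‖T z‖⁻¹ • z) ≤ planeDet p q :=
      hmax (a := (_, _)) ⟨hunit w hw, hunit z hz⟩
    have hw' := hpos w hw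
    have hz' := hpos z hz
    rw [← div_le_iff₀ (by positivity)]
    refine le_trans (le_of_eq ?_) h
    simp only [planeDet, Prod.smul_fst, Prod.smul_snd, smul_eq_mul]
    field_simp
  refine ⟨p, q, hp, hq, ?_, fun w z => ?_⟩
  · have h := hle (1, 0) (0, 1) he₁ he₂
    have h1 : planeDet (1, 0) (0, 1) = 1 := by simp [planeDet]
    rw [h1] at h
    exact pos_of_mul_pos_left (zero_lt_one.trans_le h) (by positivity)
  · rcases eq_or_ne w 0 with rfl | hw
    · simp [planeDet]
    rcases eq_or_ne z 0 with rfl | hz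
    · simp [planeDet]
    exact hle w z hw hz

/-- If rotating unit pairs never increases the sum of squared norms, then every plane in `X`
is Euclidean: a pair of unit vectors of maximal determinant behaves like an orthonormal basis. -/
theorem parallelogram_of_injective
    (h : ∀ a b : ℝ, ∀ u v : X, ‖u‖ = 1 → ‖v‖ = 1 →
      ‖a • u + b • v‖ ^ 2 + ‖a • v - b • u‖ ^ 2 ≤ 2 * (a ^ 2 + b ^ 2))
    (T : ℝ × ℝ →ₗ[ℝ] X) (hT : Function.Injective T) (w z : ℝ × ℝ) :
    ‖T w + T z‖ ^ 2 + ‖T w - T z‖ ^ 2 = 2 * ‖T w‖ ^ 2 + 2 * ‖T z‖ ^ 2 := by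
  obtain ⟨p, q, hp, hq, hpos, hmax⟩ := exists_maximal_planeDet T hT
  have hnorm : ∀ a b : ℝ, ‖T (a • p + b • q)‖ ^ 2 = a ^ 2 + b ^ 2 := by
    intro a b
    have h1 := h a b (T p) (T q) hp hq
    simp only [← map_smul, ← map_add, ← map_sub] at h1
    have h2 := hmax (a • p + b • q) (a • q - b • p)
    have h3 : planeDet (a • p + b • q) (a • q - b • p) = planeDet p q * (a ^ 2 + b ^ 2) := by
      simp only [planeDet, Prod.fst_add, Prod.snd_add, Prod.fst_sub, Prod.snd_sub,
        Prod.smul_fst, Prod.smul_snd, smul_eq_mul]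
      ring
    rw [h3] at h2
    have h4 := le_of_mul_le_mul_left h2 hpos
    set m := ‖T (a • p + b • q)‖
    set n := ‖T (a • q - b • p)‖
    have h5 : m - n = 0 := pow_eq_zero_iff two_ne_zero |>.1
      (le_antisymm (by linarith [sub_sq m n]) (sq_nonneg (m - n)))
    have h6 : n = m := by linarith
    rw [h6] at h1 h4
    nlinarith
  have hspan : ∀ r : ℝ × ℝ,
      r = (planeDet r q / planeDet p q) • p + (planeDet p r / planeDet p q) • q := by
    intro r
    have hne := hpos.ne'
    ext
    all_goals
      simp only [Prod.fst_add, Prod.snd_add, Prod.smul_fst, Prod.smul_snd, smul_eq_mul]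
      rw [div_mul_eq_mul_div, div_mul_eq_mul_div, ← add_div, eq_div_iff hne]
      simp only [planeDet]
      ring
  obtain ⟨a, b, rfl⟩ : ∃ a b : ℝ, w = a • p + b • q := ⟨_, _, hspan w⟩
  obtain ⟨c, d, rfl⟩ : ∃ c d : ℝ, z = c • p + d • q := ⟨_, _, hspan z⟩
  rw [← map_add, ← map_sub,
    show a • p + b • q + (c • p + d • q) = (a + c) • p + (b + d) • q by module,
    show a • p + b • q - (c • p + d • q) = (a - c) • p + (b - d) • q by module]
  simp only [hnorm]
  ring

/-- The parallelogram law for all pairs, assuming that rotating unit pairs never increases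
the sum of squared norms. -/
theorem parallelogram_of_norm_sq_rotate_le
    (h : ∀ a b : ℝ, ∀ u v : X, ‖u‖ = 1 → ‖v‖ = 1 →
      ‖a • u + b • v‖ ^ 2 + ‖a • v - b • u‖ ^ 2 ≤ 2 * (a ^ 2 + b ^ 2)) (x y : X) :
    ‖x + y‖ ^ 2 + ‖x - y‖ ^ 2 = 2 * ‖x‖ ^ 2 + 2 * ‖y‖ ^ 2 := by
  by_cases hxy : LinearIndependent ℝ ![x, y]
  · let T : ℝ × ℝ →ₗ[ℝ] X :=
      (LinearMap.toSpanSingleton ℝ X x).coprod (LinearMap.toSpanSingleton ℝ X y)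
    have hTapply : ∀ w : ℝ × ℝ, T w = w.1 • x + w.2 • y := fun w => rfl
    have hT : Function.Injective T := by
      rw [injective_iff_map_eq_zero]
      intro w hw
      rw [hTapply] at hw
      exact Prod.ext_iff.2 (LinearIndependent.pair_iff.1 hxy _ _ hw)
    have key := parallelogram_of_injective h T hT (1, 0) (0, 1)
    simpa [hTapply] using key
  · rcases eq_or_ne x 0 with rfl | hx
    · simp
      ring
    · rw [LinearIndependent.pair_iff' hx] at hxy
      push Not at hxy
      obtain ⟨c, rfl⟩ := hxy
      rw [show x + c • x = (1 + c) • x by module, show x - c • x = (1 - c) • x by module]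
      simp only [norm_smul, mul_pow, Real.norm_eq_abs, sq_abs]
      ring

end EqualNormPairs

/-- A nontrivial real Banach space `X` is a Hilbert space
(norm satisfies the parallelogram law) iff `L^I_YJ(τ, υ, X) = 2(τ²+υ²)/υ²`
for all `τ, υ > 0`. -/
theorem stmt12 (X : Type*) [NormedAddCommGroup X] [NormedSpace ℝ X] [CompleteSpace X]
    [Nontrivial X] :
    (∀ x y : X, ‖x + y‖ ^ 2 + ‖x - y‖ ^ 2 = 2 * ‖x‖ ^ 2 + 2 * ‖y‖ ^ 2) ↔
      ∀ τ υ : ℝ, 0 < τ → 0 < υ → LIYJ X τ υ = 2 * (τ ^ 2 + υ ^ 2) / υ ^ 2 := by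
  constructor
  · intro h τ υ hτ hυ
    suffices hset : {r : ℝ | ∃ x y : X, (x, y) ≠ (0, 0) ∧ IsoOrth x y ∧
        r = (‖(τ + υ) • x + (υ - τ) • y‖ ^ 2 + ‖(υ - τ) • x - (τ + υ) • y‖ ^ 2) /
          (υ ^ 2 * ‖x + y‖ ^ 2)} = {2 * (τ ^ 2 + υ ^ 2) / υ ^ 2} by
      rw [LIYJ, hset, csSup_singleton]
    have hval : ∀ x y : X, (x, y) ≠ (0, 0) → IsoOrth x y →
        (‖(τ + υ) • x + (υ - τ) • y‖ ^ 2 + ‖(υ - τ) • x - (τ + υ) • y‖ ^ 2) /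
          (υ ^ 2 * ‖x + y‖ ^ 2) = 2 * (τ ^ 2 + υ ^ 2) / υ ^ 2 := by
      intro x y hne hiso
      have h0 : ‖x + y‖ ≠ 0 := by
        intro h0
        have h1 : x - y = 0 := norm_eq_zero.1 (hiso.symm.trans h0)
        have h2 : x + y = 0 := norm_eq_zero.1 h0
        have hx : x = (1 / 2 : ℝ) • ((x + y) + (x - y)) := by module
        have hy : y = (1 / 2 : ℝ) • ((x + y) - (x - y)) := by module
        rw [h1, h2] at hx hy
        simp only [add_zero, sub_zero, smul_zero] at hx hy
        exact hne (by rw [hx, hy])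
      rw [show (τ + υ) • x + (υ - τ) • y = υ • (x + y) + τ • (x - y) by module,
        show (υ - τ) • x - (τ + υ) • y = υ • (x - y) - τ • (x + y) by module,
        norm_sq_add_norm_sq_rotate h υ τ (x + y) (x - y) hiso]
      field_simp
      ring
    obtain ⟨e, he⟩ := exists_ne (0 : X)
    refine Set.eq_singleton_iff_unique_mem.2 ⟨?_, ?_⟩
    · have hne : (e, (0 : X)) ≠ (0, 0) := fun h0 => he (Prod.mk.inj h0).1
      have hiso : IsoOrth e 0 := by simp [IsoOrth]
      exact ⟨e, 0, hne, hiso, (hval e 0 hne hiso).symm⟩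
    · rintro r ⟨x, y, hne, hiso, rfl⟩
      exact hval x y hne hiso
  · intro h
    refine parallelogram_of_norm_sq_rotate_le fun a b u v hu hv =>
      norm_sq_add_norm_sq_rotate_le (fun a b ha hb u v hu hv => ?_) a b hu hv
    exact norm_sq_add_norm_sq_rotate_le_of_pos hb ha (h b a hb ha) hu hv
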